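/- arXiv:1404.7711 — 4 statements merged into one kernel-verified Lean document; each statement's English description precedes it below -/
import Mathlib

section
/- Fix p ∈ (0,1). There exist a constant M > 0 and n_0 ∈ ℕ such that for all n ≥ n_0, |C(x^eq) − (1/(2 log(1/p))) · (log n)/n| ≤ M/n; that is, C(x^eq) = (1/(2 log p^{−1})) (log n)/n + O(1/n) as n → ∞. -/
open Finset MeasureTheory

/-- Coverage cost on the line `[0,1]` for placement `x` and active set `A`:
the largest distance from a point of `[0,1]` to the closest active sensor
(`1` by convention if `A = ∅`). -/
noncomputable def cost0 {n : ℕ} (x : Fin n → ℝ) (A : Finset (Fin n)) : ℝ :=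
  if A.Nonempty then ⨆ s : Set.Icc (0:ℝ) 1, ⨅ j : A, |s.1 - x j.1| else 1

/-- Probability that `A` is the active set, under independent failures with
probability `p`. -/
noncomputable def prob {n : ℕ} (p : ℝ) (A : Finset (Fin n)) : ℝ :=
  p ^ (n - A.card) * (1 - p) ^ A.card

/-- Expected coverage cost `C(x)` under independent failures with probability `p`. -/
noncomputable def expCost {n : ℕ} (p : ℝ) (x : Fin n → ℝ) : ℝ :=
  ∑ A : Finset (Fin n), prob p A * cost0 x A

/-- The equispaced placement `x^eq`, whose `i`-th entry (`i = 0, …, n-1`) is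
`(2i+1)/(2n)`. -/
noncomputable def xeq (n : ℕ) : Fin n → ℝ := fun i => (2 * (i : ℝ) + 1) / (2 * n)

/-- The `k`-th smallest element of the finite set `A` (0-based). -/
noncomputable def nth {n : ℕ} (A : Finset (Fin n)) (k : Fin A.card) : Fin n :=
  (A.orderIsoOfFin rfl k).1

/-- Coverage cost on the circle of circumference 1 for the active set `A`. -/
noncomputable def ccost0 {n : ℕ} (x : Fin n → ℝ) (A : Finset (Fin n)) : ℝ :=
  if A.Nonempty then
    ⨆ s : Set.Icc (0:ℝ) 1, ⨅ j : A, min |s.1 - x j.1| (1 - |s.1 - x j.1|)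
  else 1

/-- Expected circle coverage cost `C̃(x)`. -/
noncomputable def cExpCost {n : ℕ} (p : ℝ) (x : Fin n → ℝ) : ℝ :=
  ∑ A : Finset (Fin n), prob p A * ccost0 x A

/-- Harmonic number `H_m = ∑_{h=1}^m 1/h`. -/
noncomputable def H (m : ℕ) : ℝ := ∑ i ∈ Finset.range m, 1 / ((i : ℝ) + 1)

/-- Length of the longest run of consecutive indices of `{0, …, n-1}` not
belonging to `A`. -/
noncomputable def longestRun {n : ℕ} (A : Finset (Fin n)) : ℕ :=
  sSup {r : ℕ | ∃ a : ℕ, a + r ≤ n ∧ ∀ i : Fin n, a ≤ i.1 → i.1 < a + r → i ∉ A}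

/-- Expected cost in the Cortés (constant-number-of-failures) model where
exactly `k` sensors fail, uniformly at random. -/
noncomputable def cortesCost {n : ℕ} (k : ℕ) (x : Fin n → ℝ) : ℝ :=
  (n.choose k : ℝ)⁻¹ *
    ∑ A ∈ Finset.univ.filter (fun A : Finset (Fin n) => A.card = n - k), cost0 x A

/-- Expectation over the random uniform i.i.d. placement `x^rand ∈ [0,1]^n`
of the expected cost `C(x^rand)`. -/
noncomputable def randExp (n : ℕ) (p : ℝ) : ℝ :=
  ∫ x in Set.univ.pi (fun _ : Fin n => Set.Icc (0:ℝ) 1), expCost p x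

/-- `E[C_0(x^{rand,m})]`: expected coverage cost of `m` i.i.d. uniform sensors,
all active. -/
noncomputable def randCost0 (m : ℕ) : ℝ :=
  ∫ x in Set.univ.pi (fun _ : Fin m => Set.Icc (0:ℝ) 1), cost0 x Finset.univ

/-- `E[C^{k,n}(x^rand)]`: expectation over the random placement of the Cortés
model cost. -/
noncomputable def randCortes (n k : ℕ) : ℝ :=
  ∫ x in Set.univ.pi (fun _ : Fin n => Set.Icc (0:ℝ) 1), cortesCost k x

/-- Expectation of `f` over the random active set. -/
noncomputable def avg {n : ℕ} (p : ℝ) (f : Finset (Fin n) → ℝ) : ℝ :=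
  ∑ A : Finset (Fin n), prob p A * f A

open Classical in
/-- Indicator of the event that all sensors indexed by `U` fail and all those indexed by `V`
are active. -/
noncomputable def patternInd {n : ℕ} (U V : Finset ℕ) (A : Finset (Fin n)) : ℝ :=
  if (∀ i ∈ A, i.val ∉ U) ∧ ∀ i : Fin n, i.val ∈ V → i ∈ A then 1 else 0

lemma patternInd_nonneg {n : ℕ} (U V : Finset ℕ) (A : Finset (Fin n)) :
    0 ≤ patternInd U V A := by
  unfold patternInd; split_ifs <;> norm_num

lemma patternInd_mul {n : ℕ} (U V U' V' : Finset ℕ) (A : Finset (Fin n)) :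
    patternInd U V A * patternInd U' V' A = patternInd (U ∪ U') (V ∪ V') A := by
  unfold patternInd
  simp only [Finset.mem_union, not_or, or_imp, forall_and]
  split_ifs <;> simp_all

lemma avg_mono {n : ℕ} {p : ℝ} (hp : p ∈ Set.Ioo (0:ℝ) 1) {f g : Finset (Fin n) → ℝ}
    (h : ∀ A, f A ≤ g A) : avg p f ≤ avg p g := by
  refine Finset.sum_le_sum fun A _ => mul_le_mul_of_nonneg_left (h A) ?_
  have h0 := hp.1.le
  have h1 : 0 ≤ 1 - p := by linarith [hp.2]
  unfold prob; positivity

lemma avg_add {n : ℕ} (p : ℝ) (f g : Finset (Fin n) → ℝ) :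
    avg p (fun A => f A + g A) = avg p f + avg p g := by
  simp [avg, mul_add, Finset.sum_add_distrib]

lemma avg_sub {n : ℕ} (p : ℝ) (f g : Finset (Fin n) → ℝ) :
    avg p (fun A => f A - g A) = avg p f - avg p g := by
  simp [avg, mul_sub, Finset.sum_sub_distrib]

lemma avg_const_mul {n : ℕ} (p c : ℝ) (f : Finset (Fin n) → ℝ) :
    avg p (fun A => c * f A) = c * avg p f := by
  simp only [avg, Finset.mul_sum]
  exact Finset.sum_congr rfl fun _ _ => by ring

lemma avg_sum {n : ℕ} {ι : Type*} (p : ℝ) (s : Finset ι) (f : ι → Finset (Fin n) → ℝ) :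
    avg p (fun A => ∑ i ∈ s, f i A) = ∑ i ∈ s, avg p (f i) := by
  simp only [avg, Finset.mul_sum]
  exact Finset.sum_comm

/-- Independence of the sensors: a prescribed pattern of failures `U` and activity `V` has
probability `p ^ |U| (1 - p) ^ |V|`. -/
lemma avg_patternInd {n : ℕ} (p : ℝ) {U V : Finset ℕ} (hU : U ⊆ range n) (hV : V ⊆ range n)
    (hUV : Disjoint U V) :
    avg (n := n) p (patternInd U V) = p ^ U.card * (1 - p) ^ V.card := by
  have key := Finset.prod_add (fun i : Fin n => if i.val ∈ U then 0 else 1 - p)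
    (fun i : Fin n => if i.val ∈ V then 0 else p) Finset.univ
  have hprod : ∏ i : Fin n, ((if i.val ∈ U then 0 else 1 - p) + (if i.val ∈ V then 0 else p))
      = p ^ U.card * (1 - p) ^ V.card := by
    rw [Fin.prod_univ_eq_prod_range
      (fun i => (if i ∈ U then 0 else 1 - p) + (if i ∈ V then 0 else p)) n]
    have : ∀ i ∈ range n, (if i ∈ U then 0 else 1 - p) + (if i ∈ V then 0 else p)
        = (if i ∈ U then p else 1) * (if i ∈ V then 1 - p else 1) := by
      intro i _
      by_cases h1 : i ∈ U
      · have h2 : i ∉ V := Finset.disjoint_left.mp hUV h1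
        simp [h1, h2]
      · by_cases h2 : i ∈ V <;> simp [h1, h2]
    rw [Finset.prod_congr rfl this, Finset.prod_mul_distrib, Finset.prod_ite_mem,
      Finset.prod_ite_mem, Finset.inter_eq_right.mpr hU, Finset.inter_eq_right.mpr hV]
    simp
  rw [← hprod, key, Finset.powerset_univ]
  refine Finset.sum_congr rfl fun A _ => ?_
  unfold patternInd prob
  split_ifs with h
  · rw [Finset.prod_congr rfl (g := fun _ => 1 - p) (fun i hi => by simp [h.1 i hi]),
      Finset.prod_congr rfl (s₁ := univ \ A) (g := fun _ => p)
        (fun i hi => if_neg fun hv => (Finset.mem_sdiff.mp hi).2 (h.2 i hv))]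
    simp [Finset.card_sdiff, mul_comm]
  · rw [not_and_or] at h
    push Not at h
    rcases h with ⟨i, hi, hiU⟩ | ⟨i, hiV, hi⟩
    · rw [Finset.prod_eq_zero hi (by simp [hiU])]; simp
    · rw [Finset.prod_eq_zero (s := univ \ A) (i := i) (by simp [hi]) (by simp [hiV])]; simp

lemma avg_const {n : ℕ} (p c : ℝ) : avg (n := n) p (fun _ => c) = c := by
  have h := avg_patternInd (n := n) p (U := ∅) (V := ∅) (by simp) (by simp) (by simp)
  have h1 : (patternInd (n := n) ∅ ∅) = fun _ => (1 : ℝ) := by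
    funext A; simp [patternInd]
  have h2 := avg_const_mul (n := n) p c (fun _ => 1)
  rw [h1] at h
  rw [h] at h2
  simpa using h2

lemma iInf_dist_le {n : ℕ} (x : Fin n → ℝ) (A : Finset (Fin n)) (s : ℝ) {j : Fin n}
    (hj : j ∈ A) : ⨅ j : A, |s - x j.1| ≤ |s - x j| :=
  ciInf_le (f := fun j : A => |s - x j.1|) ⟨0, by rintro _ ⟨k, rfl⟩; exact abs_nonneg _⟩ ⟨j, hj⟩

lemma xeq_mem_Icc {n : ℕ} (i : Fin n) : xeq n i ∈ Set.Icc (0:ℝ) 1 := by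
  have h : (i.val : ℝ) + 1 ≤ n := by exact_mod_cast i.isLt
  have h0 : (0:ℝ) ≤ i.val := by positivity
  unfold xeq
  constructor
  · positivity
  · rw [div_le_one (by linarith)]; linarith

lemma le_cost0 {n : ℕ} {x : Fin n → ℝ} (hx : ∀ i, x i ∈ Set.Icc (0:ℝ) 1)
    {A : Finset (Fin n)} {c s : ℝ} (hc : c ≤ 1) (hs : s ∈ Set.Icc (0:ℝ) 1)
    (h : ∀ j ∈ A, c ≤ |s - x j|) : c ≤ cost0 x A := by
  unfold cost0
  split_ifs with hA
  · obtain ⟨j, hj⟩ := hA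
    have : Nonempty A := ⟨⟨j, hj⟩⟩
    have hb : BddAbove (Set.range fun s : Set.Icc (0:ℝ) 1 => ⨅ j : A, |s.1 - x j.1|) := by
      refine ⟨1, ?_⟩
      rintro _ ⟨s, rfl⟩
      refine (iInf_dist_le x A s hj).trans ?_
      rw [abs_le]
      constructor <;> linarith [s.2.1, s.2.2, (hx j).1, (hx j).2]
    exact (le_ciInf fun j : A => h j.1 j.2).trans (le_ciSup hb ⟨s, hs⟩)
  · exact hc

/-- A run of `t` consecutive failures forces a cost of at least `t / (2n)`. -/
lemma le_cost0_of_run {n t a : ℕ} (hat : a + t < n) {A : Finset (Fin n)}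
    (h : ∀ i ∈ A, i.val ∉ Ico (a + 1) (a + 1 + t)) : (t : ℝ) ≤ 2 * n * cost0 (xeq n) A := by
  have hn : (a : ℝ) + t + 1 ≤ n := by exact_mod_cast hat
  have ha0 : (0:ℝ) ≤ a := by positivity
  have ht0 : (0:ℝ) ≤ t := by positivity
  have hn0 : (0:ℝ) < 2 * n := by linarith
  rw [← div_le_iff₀' hn0]
  refine le_cost0 (s := (2 * a + t + 2) / (2 * n)) xeq_mem_Icc ?_ ⟨by positivity, ?_⟩ ?_
  · rw [div_le_one hn0]; linarith
  · rw [div_le_one hn0]; linarith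
  · intro j hj
    have hj' := h j hj
    rw [Finset.mem_Ico, not_and_or] at hj'
    unfold xeq
    rw [← sub_div, abs_div, abs_of_pos hn0]
    refine div_le_div_of_nonneg_right ?_ hn0.le
    rcases hj' with hj' | hj'
    · have : (j.val : ℝ) ≤ a := by exact_mod_cast (by omega : j.val ≤ a)
      refine le_trans ?_ (le_abs_self _)
      linarith
    · have : (a : ℝ) + 1 + t ≤ j.val := by exact_mod_cast (by omega : a + 1 + t ≤ j.val)
      refine le_trans ?_ (neg_le_abs _)
      linarith

/-- Number of runs of `t` failures that are immediately preceded by an active sensor. -/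
noncomputable def runCount {n : ℕ} (t : ℕ) (A : Finset (Fin n)) : ℝ :=
  ∑ a ∈ range (n - t), patternInd (Ico (a + 1) (a + 1 + t)) {a} A

open Classical in
/-- Indicator of the event that no such run of `t` failures occurs. -/
noncomputable def noRunInd {n : ℕ} (t : ℕ) (A : Finset (Fin n)) : ℝ :=
  if runCount t A = 0 then 1 else 0

lemma cost0_nonneg {n : ℕ} (A : Finset (Fin n)) : 0 ≤ cost0 (xeq n) A := by
  refine le_cost0 (s := 0) xeq_mem_Icc zero_le_one (by simp) fun j _ => abs_nonneg _

lemma le_cost0_of_runCount_ne_zero {n t : ℕ} {A : Finset (Fin n)} (h : runCount t A ≠ 0) :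
    (t : ℝ) ≤ 2 * n * cost0 (xeq n) A := by
  obtain ⟨a, ha, h⟩ := Finset.exists_ne_zero_of_sum_ne_zero h
  have hat := Finset.mem_range.mp ha
  unfold patternInd at h
  split_ifs at h with h'
  · exact le_cost0_of_run (by omega) h'.1
  · exact absurd rfl h

lemma sub_sum_noRunInd_le_cost0 {n : ℕ} (A : Finset (Fin n)) (m : ℕ) :
    (m : ℝ) - ∑ k ∈ range m, noRunInd (k + 1) A ≤ 2 * n * cost0 (xeq n) A := by
  induction m with
  | zero =>
    have := cost0_nonneg A
    simp only [CharP.cast_eq_zero, range_zero, sum_empty, sub_self]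
    positivity
  | succ m ih =>
    rw [Finset.sum_range_succ]
    have h0 : 0 ≤ ∑ k ∈ range m, noRunInd (k + 1) A :=
      Finset.sum_nonneg fun k _ => by unfold noRunInd; split_ifs <;> norm_num
    by_cases h : runCount (m + 1) A = 0
    · simp only [noRunInd, h, if_true] at ih ⊢
      push_cast; linarith
    · have := le_cost0_of_runCount_ne_zero h
      have h1 : noRunInd (m + 1) A = 0 := if_neg h
      rw [h1]; linarith

lemma run_subset_range {n t a : ℕ} (ha : a ∈ range (n - t)) :
    Ico (a + 1) (a + 1 + t) ⊆ range n ∧ {a} ⊆ range n := by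
  rw [Finset.mem_range] at ha
  constructor <;> intro i hi <;> simp at hi ⊢ <;> omega

lemma avg_runCount {n : ℕ} (p : ℝ) {t : ℕ} (ht : t ≤ n) :
    avg (n := n) p (runCount t) = (n - t) * (p ^ t * (1 - p)) := by
  unfold runCount
  rw [avg_sum, Finset.sum_congr rfl (g := fun _ => p ^ t * (1 - p))]
  · simp [Nat.cast_sub ht]
  · intro a ha
    have := run_subset_range ha
    rw [show avg (n := n) p (fun A => patternInd (Ico (a + 1) (a + 1 + t)) {a} A) = _ from
      avg_patternInd p this.1 this.2 (by simp)]
    simp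

lemma avg_run_mul_run_le {n : ℕ} {p : ℝ} (hp : p ∈ Set.Ioo (0:ℝ) 1) {t a b : ℕ}
    (ha : a ∈ range (n - t)) (hb : b ∈ range (n - t)) (hab : a < b) :
    avg (n := n) p (patternInd (Ico (a + 1) (a + 1 + t) ∪ Ico (b + 1) (b + 1 + t)) ({a} ∪ {b}))
      ≤ (p ^ t * (1 - p)) ^ 2 := by
  have h1 := run_subset_range ha
  have h2 := run_subset_range hb
  by_cases h : b ∈ Ico (a + 1) (a + 1 + t)
  · have hz : ∀ A : Finset (Fin n),
        patternInd (Ico (a + 1) (a + 1 + t) ∪ Ico (b + 1) (b + 1 + t)) ({a} ∪ {b}) A ≤ 0 := by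
      intro A
      unfold patternInd
      split_ifs with h'
      · have hbn : b < n := Finset.mem_range.mp (h2.2 (by simp))
        exact absurd (Finset.mem_union_left _ h) (h'.1 ⟨b, hbn⟩ (h'.2 _ (by simp)))
      · exact le_rfl
    refine (avg_mono hp hz).trans ?_
    rw [avg_const]; positivity
  · rw [avg_patternInd p (Finset.union_subset h1.1 h2.1) (Finset.union_subset h1.2 h2.2),
      Finset.card_union_of_disjoint, Finset.card_union_of_disjoint]
    · simp only [Nat.card_Ico, card_singleton, add_tsub_cancel_left]
      apply le_of_eq; ring
    · simp; omega
    · rw [Finset.disjoint_left]; intro i; simp only [Finset.mem_Ico] at h ⊢; omega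
    · rw [Finset.disjoint_left]; intro i
      simp only [Finset.mem_Ico, Finset.mem_union, Finset.mem_singleton] at h ⊢; omega

/-- Second moment bound: distinct runs are either independent or mutually exclusive. -/
lemma avg_runCount_sq_le {n : ℕ} {p : ℝ} (hp : p ∈ Set.Ioo (0:ℝ) 1) {t : ℕ} (ht : t ≤ n) :
    avg (n := n) p (fun A => runCount t A ^ 2)
      ≤ avg (n := n) p (runCount t) + avg (n := n) p (runCount t) ^ 2 := by
  set c := p ^ t * (1 - p) with hc
  have hc0 : 0 ≤ c ^ 2 := by positivity
  have hc1 : 0 ≤ c := mul_nonneg (pow_nonneg hp.1.le _) (by linarith [hp.2])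
  have hpair : ∀ a ∈ range (n - t), ∀ b ∈ range (n - t),
      avg (n := n) p (patternInd (Ico (a + 1) (a + 1 + t) ∪ Ico (b + 1) (b + 1 + t)) ({a} ∪ {b}))
        ≤ (if a = b then c else 0) + c ^ 2 := by
    intro a ha b hb
    rcases lt_trichotomy a b with h | h | h
    · rw [if_neg h.ne, zero_add]; exact avg_run_mul_run_le hp ha hb h
    · subst h
      have := run_subset_range ha
      rw [Finset.union_idempotent, Finset.union_idempotent,
        avg_patternInd p this.1 this.2 (by simp), if_pos rfl]
      simp only [Nat.card_Ico, card_singleton, add_tsub_cancel_left, pow_one]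
      linarith
    · rw [if_neg h.ne', zero_add, Finset.union_comm, Finset.union_comm {a}]
      exact avg_run_mul_run_le hp hb ha h
  have hexp : avg (n := n) p (fun A => runCount t A ^ 2) = ∑ a ∈ range (n - t),
      ∑ b ∈ range (n - t), avg (n := n) p
        (patternInd (Ico (a + 1) (a + 1 + t) ∪ Ico (b + 1) (b + 1 + t)) ({a} ∪ {b})) := by
    simp only [← avg_sum, runCount, sq, Finset.sum_mul_sum, patternInd_mul]
  rw [hexp, avg_runCount p ht]
  refine (Finset.sum_le_sum fun a ha => Finset.sum_le_sum fun b hb => hpair a ha b hb).trans ?_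
  apply le_of_eq
  rw [Finset.sum_congr rfl (g := fun _ => c + (n - t) * c ^ 2)]
  · simp [Nat.cast_sub ht]; ring
  · intro a ha
    rw [Finset.sum_add_distrib, Finset.sum_ite_eq, if_pos ha]
    simp [Nat.cast_sub ht]

lemma avg_noRunInd_le {n : ℕ} {p : ℝ} (hp : p ∈ Set.Ioo (0:ℝ) 1) {t : ℕ} (ht : t < n) :
    avg (n := n) p (noRunInd t) ≤ 1 / ((n - t) * (p ^ t * (1 - p))) := by
  have h2 := avg_runCount_sq_le hp ht.le
  have h1 := avg_runCount p ht.le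
  set μ : ℝ := (n - t) * (p ^ t * (1 - p)) with hμ
  have hμ0 : 0 < μ := by
    have := hp.1
    have h3 : 0 < 1 - p := by linarith [hp.2]
    have h4 : (0:ℝ) < n - t := by rw [sub_pos]; exact_mod_cast ht
    positivity
  have hle : ∀ A : Finset (Fin n),
      noRunInd t A ≤ (1 / μ ^ 2) * ((runCount t A ^ 2 - 2 * μ * runCount t A) + μ ^ 2) := by
    intro A
    unfold noRunInd
    split_ifs with h
    · rw [h]; apply le_of_eq; field_simp; ring
    · have : 0 ≤ (1 / μ ^ 2) * (runCount t A - μ) ^ 2 := by positivity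
      linarith
  refine (avg_mono hp hle).trans ?_
  rw [avg_const_mul, avg_add, avg_sub, avg_const_mul, avg_const, h1]
  rw [h1] at h2
  calc _ ≤ 1 / μ ^ 2 * (μ + μ ^ 2 - 2 * μ * μ + μ ^ 2) := by gcongr
    _ = 1 / μ := by field_simp; ring

/-- Number of initial or terminal windows in which all sensors fail. -/
noncomputable def edgeCount {n : ℕ} (A : Finset (Fin n)) : ℝ :=
  ∑ k ∈ range n, (patternInd (range (k + 1)) ∅ A + patternInd (Ico (n - (k + 1)) n) ∅ A)

/-- Number of windows of more than `t` consecutive sensors that all fail. -/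
noncomputable def longRunCount {n : ℕ} (t : ℕ) (A : Finset (Fin n)) : ℝ :=
  ∑ a ∈ range n, ∑ r ∈ Ico (t + 1) (n - a + 1), patternInd (Ico a (a + r)) ∅ A

lemma patternInd_empty_eq_one {n : ℕ} {U : Finset ℕ} {A : Finset (Fin n)}
    (h : ∀ i ∈ A, i.val ∉ U) : patternInd U ∅ A = 1 := by
  simpa [patternInd] using h

lemma le_edgeCount_of_initial {n m : ℕ} (hm : m ≤ n) {A : Finset (Fin n)}
    (h : ∀ i ∈ A, m ≤ i.val) : (m : ℝ) ≤ edgeCount A := by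
  calc (m : ℝ) = ∑ k ∈ range m, 1 := by simp
    _ ≤ ∑ k ∈ range m,
        (patternInd (range (k + 1)) ∅ A + patternInd (Ico (n - (k + 1)) n) ∅ A) := by
      refine Finset.sum_le_sum fun k hk => ?_
      have hk' := Finset.mem_range.mp hk
      rw [patternInd_empty_eq_one (U := range (k + 1)) fun i hi => by
        have := h i hi; simp; omega]
      linarith [patternInd_nonneg (Ico (n - (k + 1)) n) ∅ A]
    _ ≤ edgeCount A := by
      refine Finset.sum_le_sum_of_subset_of_nonneg (Finset.range_mono hm) fun k _ _ => ?_
      exact add_nonneg (patternInd_nonneg _ _ _) (patternInd_nonneg _ _ _)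

lemma le_edgeCount_of_terminal {n m : ℕ} (hm : m ≤ n) {A : Finset (Fin n)}
    (h : ∀ i ∈ A, i.val + m < n) : (m : ℝ) ≤ edgeCount A := by
  calc (m : ℝ) = ∑ k ∈ range m, 1 := by simp
    _ ≤ ∑ k ∈ range m,
        (patternInd (range (k + 1)) ∅ A + patternInd (Ico (n - (k + 1)) n) ∅ A) := by
      refine Finset.sum_le_sum fun k hk => ?_
      have hk' := Finset.mem_range.mp hk
      rw [patternInd_empty_eq_one (U := Ico (n - (k + 1)) n) fun i hi => by
        have := h i hi; simp; omega]
      linarith [patternInd_nonneg (range (k + 1)) ∅ A]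
    _ ≤ edgeCount A := by
      refine Finset.sum_le_sum_of_subset_of_nonneg (Finset.range_mono hm) fun k _ _ => ?_
      exact add_nonneg (patternInd_nonneg _ _ _) (patternInd_nonneg _ _ _)

lemma edgeCount_nonneg {n : ℕ} (A : Finset (Fin n)) : 0 ≤ edgeCount A :=
  Finset.sum_nonneg fun _ _ => add_nonneg (patternInd_nonneg _ _ _) (patternInd_nonneg _ _ _)

lemma longRunCount_nonneg {n : ℕ} (t : ℕ) (A : Finset (Fin n)) : 0 ≤ longRunCount t A :=
  Finset.sum_nonneg fun _ _ => Finset.sum_nonneg fun _ _ => patternInd_nonneg _ _ _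

lemma le_longRunCount {n a m : ℕ} (t : ℕ) (ham : a + m < n) {A : Finset (Fin n)}
    (h : ∀ i ∈ A, i.val ∉ Ico a (a + m)) : (m : ℝ) ≤ t + longRunCount t A := by
  have h1 : ∑ r ∈ Ico (t + 1) (n - a + 1), patternInd (Ico a (a + r)) ∅ A ≤ longRunCount t A :=
    Finset.single_le_sum
      (f := fun a => ∑ r ∈ Ico (t + 1) (n - a + 1), patternInd (Ico a (a + r)) ∅ A)
      (fun _ _ => Finset.sum_nonneg fun _ _ => patternInd_nonneg _ _ _)
      (Finset.mem_range.mpr (by omega))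
  have h2 : ∑ r ∈ Ico (t + 1) (m + 1), (1 : ℝ)
      ≤ ∑ r ∈ Ico (t + 1) (n - a + 1), patternInd (Ico a (a + r)) ∅ A := by
    calc _ ≤ ∑ r ∈ Ico (t + 1) (m + 1), patternInd (Ico a (a + r)) ∅ A := by
          refine Finset.sum_le_sum fun r hr => ?_
          rw [Finset.mem_Ico] at hr
          rw [patternInd_empty_eq_one fun i hi => by
            have := h i hi; simp only [Finset.mem_Ico] at this ⊢; omega]
      _ ≤ _ := Finset.sum_le_sum_of_subset_of_nonneg
          (Finset.Ico_subset_Ico_right (by omega)) fun _ _ _ => patternInd_nonneg _ _ _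
  have h3 : (m : ℝ) ≤ t + ∑ r ∈ Ico (t + 1) (m + 1), (1 : ℝ) := by
    simp only [sum_const, Nat.card_Ico, nsmul_eq_mul, mul_one]
    exact_mod_cast (by omega : m ≤ t + (m + 1 - (t + 1)))
  linarith

/-- The cost is controlled by the longest interior run of failures and the two edge runs. -/
lemma cost0_le {n : ℕ} (hn : 0 < n) (t : ℕ) (A : Finset (Fin n)) :
    2 * n * cost0 (xeq n) A ≤ t + 1 + longRunCount t A + 2 * edgeCount A := by
  have hE := edgeCount_nonneg A
  have hL := longRunCount_nonneg t A
  have ht0 : (0:ℝ) ≤ t := by positivity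
  have hn0 : (0:ℝ) < 2 * n := by positivity
  unfold cost0
  split_ifs with hA
  swap
  · rw [Finset.not_nonempty_iff_eq_empty] at hA
    subst hA
    have := le_edgeCount_of_initial (n := n) (m := n) le_rfl (A := ∅) (by simp)
    linarith
  rw [← le_div_iff₀' hn0]
  have : Nonempty (Set.Icc (0:ℝ) 1) := ⟨⟨0, by simp⟩⟩
  refine ciSup_le fun s => ?_
  obtain ⟨s, hs0, hs1⟩ := s
  have hdist : ∀ j ∈ A, ⨅ j : A, |s - xeq n j.1| ≤ |2 * n * s - (2 * j.val + 1)| / (2 * n) := by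
    intro j hj
    refine (iInf_dist_le (xeq n) A s hj).trans (le_of_eq ?_)
    rw [eq_div_iff hn0.ne', ← abs_of_pos hn0, ← abs_mul, abs_of_pos hn0]
    unfold xeq
    congr 1
    field_simp
  suffices h : ∃ j ∈ A, |2 * n * s - (2 * j.val + 1)|
      ≤ t + 1 + longRunCount t A + 2 * edgeCount A by
    obtain ⟨j, hj, h⟩ := h
    exact (hdist j hj).trans (div_le_div_of_nonneg_right h hn0.le)
  have hy0 : 0 ≤ 2 * n * s := by positivity
  have hy1 : 2 * n * s ≤ 2 * n := by nlinarith
  set y := 2 * n * s with hy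
  set B := A.filter fun j => (2 * (j.val : ℝ) + 1) ≤ y with hB
  set D := A.filter fun j => y < 2 * (j.val : ℝ) + 1 with hD
  have hsplit : ∀ i ∈ A, i ∈ B ∨ i ∈ D := fun i hi => by
    rcases le_or_gt (2 * (i.val : ℝ) + 1) y with h | h
    · exact Or.inl (Finset.mem_filter.mpr ⟨hi, h⟩)
    · exact Or.inr (Finset.mem_filter.mpr ⟨hi, h⟩)
  rcases B.eq_empty_or_nonempty with hBe | hBn
  · refine ⟨A.min' hA, A.min'_mem hA, ?_⟩
    have hm := le_edgeCount_of_initial (A := A) (A.min' hA).isLt.le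
      fun i hi => Fin.le_def.mp (A.min'_le i hi)
    have hd : A.min' hA ∈ D := (hsplit _ (A.min'_mem hA)).resolve_left (by simp [hBe])
    have hlt := (Finset.mem_filter.mp hd).2
    rw [abs_le]; constructor <;> linarith
  rcases D.eq_empty_or_nonempty with hDe | hDn
  · refine ⟨A.max' hA, A.max'_mem hA, ?_⟩
    have hlt := (A.max' hA).isLt
    have hm := le_edgeCount_of_terminal (A := A) (m := n - 1 - (A.max' hA).val) (by omega)
      fun i hi => by have := Fin.le_def.mp (A.le_max' i hi); omega
    have hcast : ((n - 1 - (A.max' hA).val : ℕ) : ℝ) = n - 1 - (A.max' hA).val := by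
      rw [Nat.sub_sub, Nat.cast_sub (by omega)]; push_cast; ring
    rw [hcast] at hm
    have hb : A.max' hA ∈ B := (hsplit _ (A.max'_mem hA)).resolve_right (by simp [hDe])
    have hle := (Finset.mem_filter.mp hb).2
    rw [abs_le]; constructor <;> linarith
  · obtain ⟨hlA, hl⟩ := Finset.mem_filter.mp (B.max'_mem hBn)
    obtain ⟨huA, hu⟩ := Finset.mem_filter.mp (D.min'_mem hDn)
    set l := B.max' hBn with hldef
    set u := D.min' hDn with hudef
    have hlu : l.val < u.val := by
      have : (l.val : ℝ) < u.val := by linarith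
      exact_mod_cast this
    have hgap := le_longRunCount (a := l.val + 1) (m := u.val - (l.val + 1)) t
      (by have := u.isLt; omega) (A := A) fun i hi => by
        rw [Finset.mem_Ico]
        rcases hsplit i hi with h | h
        · have := Fin.le_def.mp (B.le_max' i h); omega
        · have := Fin.le_def.mp (D.min'_le i h); omega
    rw [Nat.cast_sub (by omega)] at hgap
    push_cast at hgap
    rcases le_total (y - (2 * l.val + 1)) (2 * u.val + 1 - y) with h | h
    · exact ⟨l, hlA, by rw [abs_le]; constructor <;> linarith⟩
    · exact ⟨u, huA, by rw [abs_le]; constructor <;> linarith⟩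

lemma sum_pow_le {p : ℝ} (hp : p ∈ Set.Ioo (0:ℝ) 1) (m : ℕ) :
    ∑ k ∈ range m, p ^ k ≤ 1 / (1 - p) := by
  have h1 : 0 < 1 - p := by linarith [hp.2]
  rw [le_div_iff₀ h1, geom_sum_mul_neg]
  linarith [pow_nonneg hp.1.le m]

lemma avg_edgeCount_le {n : ℕ} {p : ℝ} (hp : p ∈ Set.Ioo (0:ℝ) 1) :
    avg (n := n) p edgeCount ≤ 2 * (1 / (1 - p)) := by
  unfold edgeCount
  rw [avg_sum]
  calc _ ≤ ∑ k ∈ range n, 2 * p ^ k := by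
        refine Finset.sum_le_sum fun k hk => ?_
        rw [Finset.mem_range] at hk
        rw [avg_add]
        erw [avg_patternInd p (by intro i; simp; omega) (by simp) (by simp),
          avg_patternInd p (by intro i; simp) (by simp) (by simp)]
        have h1 : n - (n - (k + 1)) = k + 1 := by omega
        simp only [card_range, card_empty, pow_zero, mul_one, Nat.card_Ico, h1]
        have := pow_le_pow_of_le_one hp.1.le hp.2.le (Nat.le_succ k)
        simp only [Nat.succ_eq_add_one] at this
        linarith
    _ = 2 * ∑ k ∈ range n, p ^ k := by rw [Finset.mul_sum]
    _ ≤ _ := by linarith [sum_pow_le hp n]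

lemma avg_longRunCount_le {n : ℕ} {p : ℝ} (hp : p ∈ Set.Ioo (0:ℝ) 1) (t : ℕ) :
    avg (n := n) p (longRunCount t) ≤ n * p ^ t * (1 / (1 - p)) := by
  unfold longRunCount
  rw [avg_sum]
  calc _ ≤ ∑ a ∈ range n, p ^ t * (1 / (1 - p)) := by
        refine Finset.sum_le_sum fun a ha => ?_
        rw [Finset.mem_range] at ha
        rw [avg_sum, Finset.sum_congr rfl (g := fun r => p ^ r)]
        · rw [Finset.sum_Ico_eq_sum_range]
          calc _ ≤ ∑ k ∈ range (n - a + 1 - (t + 1)), p ^ t * p ^ k := by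
                refine Finset.sum_le_sum fun k _ => ?_
                rw [← pow_add]
                exact pow_le_pow_of_le_one hp.1.le hp.2.le (by omega)
            _ = p ^ t * ∑ k ∈ range (n - a + 1 - (t + 1)), p ^ k := by rw [Finset.mul_sum]
            _ ≤ _ := mul_le_mul_of_nonneg_left (sum_pow_le hp _) (pow_nonneg hp.1.le _)
        · intro r hr
          rw [Finset.mem_Ico] at hr
          erw [avg_patternInd p (by intro i; simp; omega) (by simp) (by simp)]
          simp
    _ = _ := by simp; ring

lemma expCost_xeq_le {n : ℕ} (hn : 0 < n) {p : ℝ} (hp : p ∈ Set.Ioo (0:ℝ) 1) (t : ℕ)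
    (ht : n * p ^ t ≤ 1) : 2 * n * expCost p (xeq n) ≤ t + 1 + 5 * (1 / (1 - p)) := by
  have h := avg_mono hp (cost0_le hn t)
  rw [avg_const_mul, avg_add, avg_add, avg_const, avg_const_mul] at h
  have h1 := avg_longRunCount_le (n := n) hp t
  have h2 := avg_edgeCount_le (n := n) hp
  have h3 : 0 < 1 / (1 - p) := one_div_pos.mpr (by linarith [hp.2])
  have h4 : n * p ^ t * (1 / (1 - p)) ≤ 1 / (1 - p) := mul_le_of_le_one_left h3.le ht
  change 2 * n * avg p (cost0 (xeq n)) ≤ _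
  linarith

lemma le_expCost_xeq {n : ℕ} (hn : 0 < n) {p : ℝ} (hp : p ∈ Set.Ioo (0:ℝ) 1) (m : ℕ)
    (hm : 1 ≤ n * p ^ m) (hmn : 2 * m ≤ n) :
    m - 2 / (1 - p) ^ 2 ≤ 2 * n * expCost p (xeq n) := by
  have hp0 := hp.1
  have hq : 0 < 1 - p := by linarith [hp.2]
  have h := avg_mono hp (fun A : Finset (Fin n) => sub_sum_noRunInd_le_cost0 A m)
  rw [avg_const_mul, avg_sub, avg_const, avg_sum] at h
  change _ ≤ 2 * n * avg p (cost0 (xeq n))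
  refine le_trans (sub_le_sub_left ?_ _) h
  calc _ ≤ ∑ k ∈ range m, 2 / (1 - p) * p ^ (m - 1 - k) := by
        refine Finset.sum_le_sum fun k hk => ?_
        rw [Finset.mem_range] at hk
        refine (avg_noRunInd_le hp (t := k + 1) (by omega)).trans ?_
        have hsplit : p ^ m = p ^ (k + 1) * p ^ (m - 1 - k) := by
          rw [← pow_add]; congr 1; omega
        have hhalf : (n : ℝ) / 2 ≤ n - ((k + 1 : ℕ) : ℝ) := by
          have : (2 * (k + 1 : ℕ) : ℝ) ≤ n := by exact_mod_cast (by omega : 2 * (k + 1) ≤ n)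
          linarith
        have hn0 : (0:ℝ) < n := by exact_mod_cast hn
        calc 1 / ((n - ((k + 1 : ℕ) : ℝ)) * (p ^ (k + 1) * (1 - p)))
            ≤ 1 / ((n : ℝ) / 2 * (p ^ (k + 1) * (1 - p))) := by gcongr
          _ ≤ (n * p ^ m) / ((n : ℝ) / 2 * (p ^ (k + 1) * (1 - p))) := by gcongr
          _ = 2 / (1 - p) * p ^ (m - 1 - k) := by rw [hsplit]; field_simp
    _ = 2 / (1 - p) * ∑ k ∈ range m, p ^ k := by
        rw [← Finset.mul_sum, Finset.sum_range_reflect (fun k => p ^ k) m]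
    _ ≤ 2 / (1 - p) * (1 / (1 - p)) :=
        mul_le_mul_of_nonneg_left (sum_pow_le hp m) (by positivity)
    _ = 2 / (1 - p) ^ 2 := by field_simp

/-- `C(x^eq) = (1/(2 log p⁻¹)) (log n)/n + O(1/n)` as `n → ∞`. -/
theorem expCost_xeq_asymptotic (p : ℝ) (hp : p ∈ Set.Ioo (0:ℝ) 1) :
    ∃ M : ℝ, 0 < M ∧ ∃ n0 : ℕ, ∀ n : ℕ, n0 ≤ n →
      |expCost p (xeq n) - 1 / (2 * Real.log (1 / p)) * (Real.log n / n)|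
        ≤ M / n := by
  have hq : 0 < 1 - p := by linarith [hp.2]
  have hlam : 0 < Real.log (1 / p) := Real.log_pos (by rw [lt_div_iff₀ hp.1]; linarith [hp.2])
  have hpexp : ∀ k : ℕ, p ^ k = Real.exp (-(k * Real.log (1 / p))) := by
    intro k
    rw [one_div, Real.log_inv, mul_neg, neg_neg, Real.exp_nat_mul, Real.exp_log hp.1]
  set lam := Real.log (1 / p) with hlamdef
  have hlarge : ∀ᶠ n : ℕ in Filter.atTop, Real.log n ≤ lam / 2 * n := by
    have := (Real.isLittleO_log_id_atTop.def (half_pos hlam)).natCast_atTop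
    filter_upwards [this] with n hn
    simp only [Real.norm_eq_abs, id] at hn
    rw [Nat.abs_cast] at hn
    exact (le_abs_self _).trans hn
  obtain ⟨n0, hn0⟩ := Filter.eventually_atTop.mp hlarge
  have hA : 0 < 5 * (1 / (1 - p)) := by positivity
  have hB : 0 < 2 / (1 - p) ^ 2 := by positivity
  refine ⟨2 + 5 * (1 / (1 - p)) + 2 / (1 - p) ^ 2, by positivity, n0 + 1, fun n hn => ?_⟩
  have hnpos : 0 < n := by omega
  have hnR : (0:ℝ) < n := by exact_mod_cast hnpos
  have hlog := hn0 n (by omega)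
  have hlog0 : 0 ≤ Real.log n := Real.log_natCast_nonneg n
  set z := Real.log n / lam with hz
  have hz0 : 0 ≤ z := by positivity
  have hzlam : z * lam = Real.log n := by rw [hz]; field_simp
  have hmul : ∀ k : ℕ, n * p ^ k = Real.exp (Real.log n - k * lam) := by
    intro k
    rw [hpexp, sub_eq_add_neg, Real.exp_add, Real.exp_log hnR]
  have hup := expCost_xeq_le hnpos hp ⌈z⌉₊ (by
    rw [hmul, Real.exp_le_one_iff, ← hzlam]
    nlinarith [Nat.le_ceil z])
  have hlow := le_expCost_xeq hnpos hp ⌊z⌋₊ (by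
    rw [hmul, Real.one_le_exp_iff, ← hzlam]
    nlinarith [Nat.floor_le hz0]) (by
    have h1 := Nat.floor_le hz0
    have h2 : z ≤ n / 2 := by rw [hz, div_le_iff₀ hlam]; linarith
    have h3 : (2 * (⌊z⌋₊ : ℕ) : ℝ) ≤ n := by linarith
    exact_mod_cast h3)
  have hc := Nat.ceil_lt_add_one hz0
  have hf := Nat.lt_floor_add_one z
  have heq : expCost p (xeq n) - 1 / (2 * lam) * (Real.log n / n)
      = (2 * n * expCost p (xeq n) - z) / 2 / n := by
    rw [hz]; field_simp
  rw [heq, abs_div, abs_of_pos hnR]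
  refine div_le_div_of_nonneg_right ?_ hnR.le
  rw [abs_le]
  constructor <;> linarith
end

section
/- Fix n ≥ 1 and p ∈ (0,1). The equispaced placement x^eq minimizes the expected circle cost: C̃(x^eq) ≤ C̃(x) for every x ∈ [0,1]^n. Moreover it is the unique minimizer up to rotation: if an ordered x ∈ [0,1]^n (x_1 ≤ … ≤ x_n) satisfies C̃(x) = C̃(x^eq), then x_{i+1} − x_i = 1/n for all i = 1,…,n−1 and 1 − x_n + x_1 = 1/n. -/
open Finset MeasureTheory

lemma exists_min_eq_abs_add_int {u : ℝ} (hu : |u| ≤ 1) :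
    ∃ t : ℤ, min |u| (1 - |u|) = |u + t| := by
  rcases le_total |u| (1 - |u|) with h | h
  · exact ⟨0, by simp [min_eq_left h]⟩
  · rw [min_eq_right h]
    rcases le_total 0 u with h0 | h0
    · refine ⟨-1, ?_⟩
      rw [abs_of_nonneg h0] at *
      push_cast
      rw [abs_of_nonpos (by linarith)]
      ring
    · refine ⟨1, ?_⟩
      rw [abs_of_nonpos h0] at *
      push_cast
      rw [abs_of_nonneg (by linarith)]
      ring

lemma min_le_abs_add_int (u : ℝ) (t : ℤ) : min |u| (1 - |u|) ≤ |u + t| := by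
  rcases eq_or_ne t 0 with rfl | ht
  · simp
  · have h1 : (1 : ℝ) ≤ |(t : ℝ)| := by exact_mod_cast Int.one_le_abs ht
    have h2 : |(t : ℝ)| ≤ |u + t| + |u| := by
      simpa using abs_sub (u + t) u
    exact (min_le_right _ _).trans (by linarith)

lemma sum_prob_mul_comp_map {n : ℕ} (p : ℝ) (f : Finset (Fin n) → ℝ) (e : Equiv.Perm (Fin n)) :
    ∑ A, prob p A * f (A.map e.toEmbedding) = ∑ A, prob p A * f A := by
  refine Fintype.sum_equiv e.finsetCongr _ _ fun A => ?_
  simp [prob]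

lemma ccost0_comp_perm {n : ℕ} (x : Fin n → ℝ) (e : Equiv.Perm (Fin n)) (A : Finset (Fin n)) :
    ccost0 (x ∘ e) A = ccost0 x (A.map e.toEmbedding) := by
  simp only [ccost0, Finset.map_nonempty]
  congr 2
  ext s
  refine Equiv.iInf_congr (e.subtypeEquiv fun a => by simp) fun j => ?_
  simp

lemma cExpCost_comp_perm {n : ℕ} (p : ℝ) (x : Fin n → ℝ) (e : Equiv.Perm (Fin n)) :
    cExpCost p (x ∘ e) = cExpCost p x := by
  simp only [cExpCost, ccost0_comp_perm]
  exact sum_prob_mul_comp_map p (ccost0 x) e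

lemma prob_pos {n : ℕ} {p : ℝ} (hp : p ∈ Set.Ioo (0:ℝ) 1) (A : Finset (Fin n)) : 0 < prob p A :=
  mul_pos (pow_pos hp.1 _) (pow_pos (sub_pos.2 hp.2) _)

/-- The residue class of an integer, as an index in `Fin n`. -/
def cycIdx (n : ℕ) [NeZero n] (m : ℤ) : Fin n :=
  ⟨(m % n).toNat, by
    have := Int.emod_lt_of_pos m (Nat.cast_pos.2 (NeZero.pos n))
    have := Int.emod_nonneg m (Nat.cast_ne_zero.2 (NeZero.ne n))
    omega⟩

/-- The lift to the real line of a configuration on the circle of circumference `1`. -/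
noncomputable def lineLift {n : ℕ} [NeZero n] (x : Fin n → ℝ) (m : ℤ) : ℝ :=
  x (cycIdx n m) + ((m / n : ℤ) : ℝ)

section CircleCoverage

variable {n : ℕ} [NeZero n]

lemma cycIdx_val (m : ℤ) : ((cycIdx n m : ℕ) : ℤ) = m % n := by
  have := Int.emod_nonneg m (Nat.cast_ne_zero.2 (NeZero.ne n))
  simp only [cycIdx]
  omega

lemma cycIdx_coe_add_mul (j : Fin n) (t : ℤ) : cycIdx n (j + t * n) = j := by
  apply Fin.ext
  zify
  rw [cycIdx_val, Int.add_mul_emod_self_right, Int.emod_eq_of_lt] <;> omega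

lemma cycIdx_add_coe (m : ℤ) (k : Fin n) : cycIdx n (m + k) = cycIdx n m + k := by
  apply Fin.ext
  zify
  rw [cycIdx_val, Fin.val_add]
  push_cast
  rw [cycIdx_val, Int.emod_add_emod]

lemma lineLift_coe_add_mul (x : Fin n → ℝ) (j : Fin n) (t : ℤ) :
    lineLift x (j + t * n) = x j + t := by
  have hn : (n : ℤ) ≠ 0 := Nat.cast_ne_zero.2 (NeZero.ne n)
  rw [lineLift, cycIdx_coe_add_mul, Int.add_mul_ediv_right _ _ hn,
    Int.ediv_eq_zero_of_lt (by omega) (by omega), zero_add]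

lemma lineLift_coe (x : Fin n → ℝ) (j : Fin n) : lineLift x j = x j := by
  simpa using lineLift_coe_add_mul x j 0

lemma cycIdx_add_period (m : ℤ) : cycIdx n (m + n) = cycIdx n m := by
  apply Fin.ext
  zify
  rw [cycIdx_val, cycIdx_val, Int.add_emod_right]

lemma lineLift_add_period (x : Fin n → ℝ) (m : ℤ) : lineLift x (m + n) = lineLift x m + 1 := by
  have hn : (n : ℤ) ≠ 0 := Nat.cast_ne_zero.2 (NeZero.ne n)
  rw [lineLift, lineLift, cycIdx_add_period, Int.add_ediv_of_dvd_right (dvd_refl _), Int.ediv_self hn]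
  push_cast
  ring

lemma lineLift_monotone {x : Fin n → ℝ} (hx : ∀ i, x i ∈ Set.Icc (0:ℝ) 1) (hm : Monotone x) :
    Monotone (lineLift x) := by
  intro a b hab
  have hn : (0 : ℤ) < n := Nat.cast_pos.2 (NeZero.pos n)
  rcases (Int.ediv_le_ediv hn hab).eq_or_lt with h | h
  · rw [lineLift, lineLift, h]
    have : cycIdx n a ≤ cycIdx n b := by
      rw [Fin.le_def]
      zify
      rw [cycIdx_val, cycIdx_val]
      have h₁ := Int.emod_add_mul_ediv a n
      have h₂ := Int.emod_add_mul_ediv b n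
      rw [h] at h₁
      linarith
    linarith [hm this]
  · have h' : (((a / n : ℤ) : ℝ)) + 1 ≤ ((b / n : ℤ) : ℝ) := by exact_mod_cast h
    rw [lineLift, lineLift]
    linarith [(hx (cycIdx n a)).2, (hx (cycIdx n b)).1]

lemma lineLift_xeq (m : ℤ) : lineLift (xeq n) m = (2 * m + 1) / (2 * n) := by
  have hn : (n : ℝ) ≠ 0 := Nat.cast_ne_zero.2 (NeZero.ne n)
  have h : ((cycIdx n m : ℕ) : ℤ) + n * (m / n) = m := by
    rw [cycIdx_val, Int.emod_add_mul_ediv]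
  have h' : ((cycIdx n m : ℕ) : ℝ) + n * ((m / n : ℤ) : ℝ) = m := by exact_mod_cast h
  rw [lineLift, xeq, ← h']
  field_simp
  ring

lemma sum_lineLift_shift (x : Fin n → ℝ) (c : ℤ) (L : ℕ) :
    ∑ k : Fin n, lineLift x (c + L + k) = ∑ k : Fin n, lineLift x (c + k) + L := by
  induction L with
  | zero => simp
  | succ L ih =>
    have key : ∀ d : ℤ, ∑ k : Fin n, lineLift x (d + 1 + k)
        = ∑ k : Fin n, lineLift x (d + k) + 1 := by
      intro d
      rw [Fin.sum_univ_eq_sum_range (fun k : ℕ => lineLift x (d + 1 + k)) n,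
        Fin.sum_univ_eq_sum_range (fun k : ℕ => lineLift x (d + k)) n]
      have h₁ := Finset.sum_range_succ (fun k : ℕ => lineLift x (d + k)) n
      have h₂ := Finset.sum_range_succ' (fun k : ℕ => lineLift x (d + k)) n
      have h₃ := lineLift_add_period x d
      have h₄ : ∑ k ∈ Finset.range n, lineLift x (d + 1 + k)
          = ∑ k ∈ Finset.range n, lineLift x (d + ((k + 1 : ℕ) : ℤ)) :=
        Finset.sum_congr rfl fun k _ => by
          congr 1
          push_cast
          ring
      simp only [Nat.cast_zero, add_zero] at h₂
      linarith
    have h := key (c + L)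
    rw [ih] at h
    push_cast
    rw [← add_assoc, ← add_assoc, h]

lemma iInf_circleDist_le (x : Fin n → ℝ) {A : Finset (Fin n)} (s : ℝ) {m : ℤ}
    (hm : cycIdx n m ∈ A) :
    ⨅ j : A, min |s - x j.1| (1 - |s - x j.1|) ≤ |s - lineLift x m| := by
  refine (ciInf_le (Set.finite_range _).bddBelow (⟨cycIdx n m, hm⟩ : A)).trans ?_
  have := min_le_abs_add_int (s - x (cycIdx n m)) (-(m / n))
  rw [lineLift, ← sub_sub]
  simpa [sub_eq_add_neg] using this

/-- Half the length of an arc free of active sensors is a lower bound for the cost. -/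
lemma half_arc_le_ccost0 {x : Fin n → ℝ} (hx : ∀ i, x i ∈ Set.Icc (0:ℝ) 1) (hm : Monotone x)
    {A : Finset (Fin n)} (hA : A.Nonempty) {a b : ℤ}
    (hgap : ∀ m, a < m → m < b → cycIdx n m ∉ A) :
    (lineLift x b - lineLift x a) / 2 ≤ ccost0 x A := by
  have hmono := lineLift_monotone hx hm
  rw [ccost0, if_pos hA]
  have : Nonempty A := hA.to_subtype
  set c := (lineLift x a + lineLift x b) / 2 with hc
  have hbdd : BddAbove (Set.range fun s : Set.Icc (0:ℝ) 1 =>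
      ⨅ j : A, min |s.1 - x j.1| (1 - |s.1 - x j.1|)) := by
    refine ⟨1, ?_⟩
    rintro _ ⟨s, rfl⟩
    obtain ⟨j⟩ := this
    refine (ciInf_le (Set.finite_range _).bddBelow j).trans ((min_le_right _ _).trans ?_)
    linarith [abs_nonneg (s.1 - x j.1)]
  refine le_trans ?_ (le_ciSup hbdd
    ⟨Int.fract c, Int.fract_nonneg c, (Int.fract_lt_one c).le⟩)
  refine le_ciInf fun j => ?_
  have hu : |Int.fract c - x j.1| ≤ 1 := abs_sub_le_iff.2
    ⟨by linarith [Int.fract_lt_one c, (hx j.1).1], by linarith [Int.fract_nonneg c, (hx j.1).2]⟩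
  obtain ⟨t, ht⟩ := exists_min_eq_abs_add_int hu
  change _ ≤ min |Int.fract c - x j.1| (1 - |Int.fract c - x j.1|)
  rw [ht]
  have hl := lineLift_coe_add_mul x j.1 (⌊c⌋ - t)
  have hj : cycIdx n (j.1 + (⌊c⌋ - t) * n) ∈ A := by
    rw [cycIdx_coe_add_mul]
    exact j.2
  push_cast at hl
  rw [show Int.fract c - x j.1 + t = c - lineLift x (j.1 + (⌊c⌋ - t) * n) by
    rw [hl, Int.fract]; ring]
  rcases le_or_gt ((j.1 : ℤ) + (⌊c⌋ - t) * n) a with h | h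
  · refine le_trans ?_ (le_abs_self _)
    linarith [hmono h]
  · rcases lt_or_ge ((j.1 : ℤ) + (⌊c⌋ - t) * n) b with h' | h'
    · exact absurd hj (hgap _ h h')
    · refine le_trans ?_ (neg_le_abs _)
      linarith [hmono h']

/-- The cost of the equispaced placement is attained at an arc free of active sensors. -/
lemma exists_gap_ccost0_xeq_le {A : Finset (Fin n)} (hA : A.Nonempty) :
    ∃ (a : ℤ) (L : ℕ), (∀ m, a < m → m < a + L → cycIdx n m ∉ A) ∧
      ccost0 (xeq n) A ≤ L / (2 * n) := by
  classical
  have hn : (0 : ℝ) < n := Nat.cast_pos.2 (NeZero.pos n)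
  have hnz : (0 : ℤ) < n := Nat.cast_pos.2 (NeZero.pos n)
  obtain ⟨j, hj⟩ := hA
  let P : ℕ → Prop := fun L => ∃ a : ℤ, ∀ m, a < m → m < a + L → cycIdx n m ∉ A
  have hP0 : P 0 := ⟨0, fun m h₁ h₂ => by push_cast at h₂; omega⟩
  obtain ⟨a, ha⟩ := Nat.findGreatest_spec (Nat.zero_le n) hP0
  refine ⟨a, Nat.findGreatest P n, ha, ?_⟩
  rw [ccost0, if_pos ⟨j, hj⟩]
  have : Nonempty (Set.Icc (0:ℝ) 1) := ⟨⟨0, by simp⟩⟩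
  refine ciSup_le fun s => ?_
  obtain ⟨l, ⟨hlA, hls⟩, hlmax⟩ := Int.exists_greatest_of_bdd
    (P := fun m => cycIdx n m ∈ A ∧ lineLift (xeq n) m ≤ s.1)
    ⟨n, fun m hm => by
      have h := hm.2.trans s.2.2
      rw [lineLift_xeq, div_le_one (by positivity)] at h
      have : (m : ℝ) ≤ n := by linarith
      exact_mod_cast this⟩
    ⟨j + (-1) * n, by rwa [cycIdx_coe_add_mul], by
      have hj1 : ((j : ℕ) : ℝ) + 1 ≤ n := by exact_mod_cast j.2
      rw [lineLift_xeq]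
      refine (div_nonpos_of_nonpos_of_nonneg ?_ (by positivity)).trans s.2.1
      push_cast
      linarith⟩
  obtain ⟨r, ⟨hrl, hrA⟩, hrmin⟩ := Int.exists_least_of_bdd
    (P := fun m => l < m ∧ cycIdx n m ∈ A) ⟨l, fun m hm => hm.1.le⟩
    ⟨l + n, by omega, by rwa [cycIdx_add_period]⟩
  have hrn : r ≤ l + n := hrmin _ ⟨by omega, by rwa [cycIdx_add_period]⟩
  have hrs : s.1 ≤ lineLift (xeq n) r := by
    by_contra! h
    exact absurd (hlmax r ⟨hrA, h.le⟩) (not_le.2 hrl)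
  have hle : (r - l).toNat ≤ Nat.findGreatest P n := by
    refine Nat.le_findGreatest (by omega) ⟨l, fun m h₁ h₂ hm => ?_⟩
    have := hrmin m ⟨h₁, hm⟩
    omega
  have hle' : (r : ℝ) - l ≤ (Nat.findGreatest P n : ℕ) := by
    have : r - l ≤ (Nat.findGreatest P n : ℕ) := by omega
    exact_mod_cast this
  have h₁ := iInf_circleDist_le (xeq n) s.1 hlA
  have h₂ := iInf_circleDist_le (xeq n) s.1 hrA
  rw [abs_of_nonneg (sub_nonneg.2 hls)] at h₁
  rw [abs_of_nonpos (sub_nonpos.2 hrs)] at h₂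
  have h₃ : lineLift (xeq n) r - lineLift (xeq n) l = 2 * (((r : ℝ) - l) / (2 * n)) := by
    rw [lineLift_xeq, lineLift_xeq]
    ring
  have h₄ : ((r : ℝ) - l) / (2 * n) ≤ (Nat.findGreatest P n : ℕ) / (2 * n) := by gcongr
  linarith

lemma cycIdx_mem_map_addRight (A : Finset (Fin n)) (m : ℤ) (k : Fin n) :
    cycIdx n m ∈ A.map (Equiv.addRight k).toEmbedding ↔ cycIdx n (m - k) ∈ A := by
  have h := cycIdx_add_coe (m - k) k
  rw [sub_add_cancel] at h
  rw [h]
  simp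

/-- Averaging the cost over all rotations of the active set cannot beat the equispaced
placement. -/
lemma card_mul_ccost0_xeq_le_sum {x : Fin n → ℝ} (hx : ∀ i, x i ∈ Set.Icc (0:ℝ) 1)
    (hm : Monotone x) (A : Finset (Fin n)) :
    n * ccost0 (xeq n) A ≤ ∑ k : Fin n, ccost0 x (A.map (Equiv.addRight k).toEmbedding) := by
  have hn : (0 : ℝ) < n := Nat.cast_pos.2 (NeZero.pos n)
  rcases A.eq_empty_or_nonempty with rfl | hA
  · simp [ccost0]
  obtain ⟨a, L, hgap, hle⟩ := exists_gap_ccost0_xeq_le hA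
  calc n * ccost0 (xeq n) A ≤ n * (L / (2 * n)) := by gcongr
    _ = (∑ k : Fin n, lineLift x (a + L + k) - ∑ k : Fin n, lineLift x (a + k)) / 2 := by
      rw [sum_lineLift_shift]
      field_simp
      ring
    _ = ∑ k : Fin n, (lineLift x (a + L + k) - lineLift x (a + k)) / 2 := by
      rw [← Finset.sum_sub_distrib, Finset.sum_div]
    _ ≤ _ := Finset.sum_le_sum fun k _ =>
      half_arc_le_ccost0 hx hm (hA.map) fun m h₁ h₂ => by
        rw [cycIdx_mem_map_addRight]
        exact hgap _ (by omega) (by omega)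

lemma ccost0_xeq_univ_le : ccost0 (xeq n) univ ≤ 1 / (2 * n) := by
  obtain ⟨a, L, hgap, hle⟩ := exists_gap_ccost0_xeq_le (n := n) univ_nonempty
  refine hle.trans ?_
  have hL : L ≤ 1 := by
    by_contra! h
    exact hgap (a + 1) (by omega) (by omega) (mem_univ _)
  gcongr
  exact_mod_cast hL

lemma card_mul_cExpCost (p : ℝ) (x : Fin n → ℝ) :
    n * cExpCost p x =
      ∑ A, prob p A * ∑ k : Fin n, ccost0 x (A.map (Equiv.addRight k).toEmbedding) := by
  simp_rw [Finset.mul_sum]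
  rw [Finset.sum_comm]
  simp_rw [sum_prob_mul_comp_map]
  simp [cExpCost]

lemma cExpCost_xeq_le {p : ℝ} (hp : p ∈ Set.Ioo (0:ℝ) 1) {x : Fin n → ℝ}
    (hx : ∀ i, x i ∈ Set.Icc (0:ℝ) 1) : cExpCost p (xeq n) ≤ cExpCost p x := by
  have hn : (0 : ℝ) < n := Nat.cast_pos.2 (NeZero.pos n)
  rw [← cExpCost_comp_perm p x (Tuple.sort x)]
  refine le_of_mul_le_mul_left ?_ hn
  rw [card_mul_cExpCost p (x ∘ _), cExpCost, Finset.mul_sum]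
  refine Finset.sum_le_sum fun A _ => ?_
  rw [mul_left_comm]
  exact mul_le_mul_of_nonneg_left
    (card_mul_ccost0_xeq_le_sum (fun i => hx _) (Tuple.monotone_sort x) A) (prob_pos hp A).le

/-- A sorted minimizer costs no more than the equispaced placement when all sensors are active. -/
lemma ccost0_univ_le_of_cExpCost_eq {p : ℝ} (hp : p ∈ Set.Ioo (0:ℝ) 1) {x : Fin n → ℝ}
    (hx : ∀ i, x i ∈ Set.Icc (0:ℝ) 1) (hm : Monotone x)
    (h : cExpCost p x = cExpCost p (xeq n)) : ccost0 x univ ≤ ccost0 (xeq n) univ := by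
  have hn : (0 : ℝ) < n := Nat.cast_pos.2 (NeZero.pos n)
  by_contra! hlt
  suffices n * cExpCost p (xeq n) < n * cExpCost p x by
    rw [h] at this
    exact lt_irrefl _ this
  rw [card_mul_cExpCost p x, cExpCost, Finset.mul_sum]
  refine Finset.sum_lt_sum (fun A _ => ?_) ⟨univ, mem_univ _, ?_⟩
  · rw [mul_left_comm]
    exact mul_le_mul_of_nonneg_left (card_mul_ccost0_xeq_le_sum hx hm A) (prob_pos hp A).le
  · rw [mul_left_comm]
    refine mul_lt_mul_of_pos_left ?_ (prob_pos hp _)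
    simpa using mul_lt_mul_of_pos_left hlt hn

/-- The consecutive gaps of a sorted minimizer are all equal. -/
lemma lineLift_gap_of_cExpCost_eq {p : ℝ} (hp : p ∈ Set.Ioo (0:ℝ) 1) {x : Fin n → ℝ}
    (hx : ∀ i, x i ∈ Set.Icc (0:ℝ) 1) (hm : Monotone x)
    (h : cExpCost p x = cExpCost p (xeq n)) (i : Fin n) :
    lineLift x (i + 1) - lineLift x i = 1 / n := by
  have hn : (0 : ℝ) < n := Nat.cast_pos.2 (NeZero.pos n)
  have hle : ∀ k ∈ (univ : Finset (Fin n)), lineLift x (k + 1) - lineLift x k ≤ 1 / n := by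
    intro k _
    have h₁ := half_arc_le_ccost0 hx hm (A := univ) univ_nonempty (a := k) (b := k + 1)
      (fun m h₁ h₂ => by omega)
    have h₂ := (ccost0_univ_le_of_cExpCost_eq hp hx hm h).trans ccost0_xeq_univ_le
    have h₃ : (1 : ℝ) / n = 2 * (1 / (2 * n)) := by field_simp
    linarith
  have hsum : ∑ k : Fin n, (lineLift x (k + 1) - lineLift x k) = ∑ _k : Fin n, (1 : ℝ) / n := by
    have := sum_lineLift_shift x 0 1
    simp only [Nat.cast_one, zero_add] at this
    rw [Finset.sum_sub_distrib]
    simp_rw [add_comm _ (1 : ℤ)]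
    rw [this]
    simp [hn.ne']
  exact (Finset.sum_eq_sum_iff_of_le hle).1 hsum i (mem_univ i)

end CircleCoverage

/-- the equispaced placement minimizes the expected circle cost
`C̃`, and any ordered minimizer has all consecutive gaps (including the wrap-
around gap) equal to `1/n`, i.e. it is `x^eq` up to rotation. -/
theorem xeq_optimal_circle {n : ℕ} (hn : 1 ≤ n) (p : ℝ)
    (hp : p ∈ Set.Ioo (0:ℝ) 1) :
    (∀ x : Fin n → ℝ, (∀ i, x i ∈ Set.Icc (0:ℝ) 1) →
        cExpCost p (xeq n) ≤ cExpCost p x) ∧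
    (∀ x : Fin n → ℝ, (∀ i, x i ∈ Set.Icc (0:ℝ) 1) → Monotone x →
      cExpCost p x = cExpCost p (xeq n) →
        (∀ i : Fin n, ∀ h : i.1 + 1 < n, x ⟨i.1 + 1, h⟩ - x i = 1 / n) ∧
        1 - x ⟨n - 1, by omega⟩ + x ⟨0, by omega⟩ = 1 / n) := by
  have : NeZero n := ⟨by omega⟩
  refine ⟨fun x hx => cExpCost_xeq_le hp hx, fun x hx hm h => ⟨fun i hi => ?_, ?_⟩⟩
  · have hgap := lineLift_gap_of_cExpCost_eq hp hx hm h i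
    have hnext := lineLift_coe x ⟨i.1 + 1, hi⟩
    push_cast at hnext
    rwa [hnext, lineLift_coe] at hgap
  · have hgap := lineLift_gap_of_cExpCost_eq hp hx hm h ⟨n - 1, by omega⟩
    have hfirst := lineLift_coe_add_mul x ⟨0, by omega⟩ 1
    have hidx : ((n - 1 : ℕ) : ℤ) + 1 = ((0 : ℕ) : ℤ) + 1 * n := by omega
    rw [lineLift_coe, hidx, hfirst] at hgap
    push_cast at hgap
    linarith
end

section
/- Let x ∈ [0,1]^n be ordered (x_1 ≤ … ≤ x_n) and let A ⊆ {1,…,n} be nonempty with elements A_1 < … < A_{|A|}. Then C̃_0(x_A) ≤ C_0(x_A); moreover, if C̃_0(x_A) < C_0(x_A), then C_0(x_A) = max{ x_{A_1}, 1 − x_{A_{|A|}} }. -/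
open Finset MeasureTheory

/-- Between two active sensors, the distance to the nearest active sensor on the line is at most
the one on the circle. -/
lemma iInf_abs_sub_le_iInf_circle {n : ℕ} {x : Fin n → ℝ} (hx : ∀ i, x i ∈ Set.Icc (0:ℝ) 1)
    {A : Finset (Fin n)} (a b : A) {s : ℝ} (ha : x a.1 ≤ s) (hb : s ≤ x b.1) :
    ⨅ j : A, |s - x j.1| ≤ ⨅ j : A, min |s - x j.1| (1 - |s - x j.1|) := by
  have hle (j : A) : ⨅ j : A, |s - x j.1| ≤ |s - x j.1| := ciInf_le (Set.finite_range _).bddBelow j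
  have hla := hle a
  have hlb := hle b
  rw [abs_of_nonneg (by linarith)] at hla
  rw [abs_of_nonpos (by linarith)] at hlb
  have : Nonempty A := ⟨a⟩
  refine le_ciInf fun j => le_min (hle j) ?_
  obtain ⟨hj0, hj1⟩ := hx j.1
  obtain ⟨ha0, -⟩ := hx a.1
  obtain ⟨-, hb1⟩ := hx b.1
  rcases abs_cases (s - x j.1) with h | h <;> linarith

/-- The distance to the nearest active sensor is bounded uniformly on `[0,1]`. -/
lemma bddAbove_range_iInf_abs_sub {n : ℕ} {x : Fin n → ℝ} (hx : ∀ i, x i ∈ Set.Icc (0:ℝ) 1)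
    {A : Finset (Fin n)} (hA : A.Nonempty) :
    BddAbove (Set.range fun s : Set.Icc (0:ℝ) 1 => ⨅ j : A, |s.1 - x j.1|) := by
  obtain ⟨i, hi⟩ := hA
  refine ⟨1, ?_⟩
  rintro _ ⟨⟨s, hs0, hs1⟩, rfl⟩
  refine (ciInf_le (Set.finite_range _).bddBelow (⟨i, hi⟩ : A)).trans ?_
  obtain ⟨h0, h1⟩ := hx i
  exact abs_le.2 ⟨by linarith, by linarith⟩

/-- At each point, the circle distance to the nearest active sensor is at most the line distance. -/
lemma iInf_circle_le_iInf_abs_sub {n : ℕ} (x : Fin n → ℝ) (A : Finset (Fin n)) (s : ℝ) :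
    ⨅ j : A, min |s - x j.1| (1 - |s - x j.1|) ≤ ⨅ j : A, |s - x j.1| :=
  ciInf_mono (Set.finite_range _).bddBelow fun _ => min_le_left _ _

/-- for ordered `x ∈ [0,1]^n` and nonempty `A`,
`C̃_0(x_A) ≤ C_0(x_A)`, and if the inequality is strict then
`C_0(x_A) = max{x_{A_1}, 1 - x_{A_{|A|}}}`. -/
theorem ccost0_le_cost0 {n : ℕ} (x : Fin n → ℝ)
    (hx : ∀ i, x i ∈ Set.Icc (0:ℝ) 1) (hmono : Monotone x)
    (A : Finset (Fin n)) (hA : A.Nonempty) :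
    ccost0 x A ≤ cost0 x A ∧
    (ccost0 x A < cost0 x A →
      cost0 x A = max (x (nth A ⟨0, hA.card_pos⟩))
        (1 - x (nth A ⟨A.card - 1, by have := hA.card_pos; omega⟩))) := by
  have hbdd := bddAbove_range_iInf_abs_sub hx hA
  have hcbdd : BddAbove (Set.range fun s : Set.Icc (0:ℝ) 1 =>
      ⨅ j : A, min |s.1 - x j.1| (1 - |s.1 - x j.1|)) :=
    hbdd.range_mono _ fun s => iInf_circle_le_iInf_abs_sub x A s.1
  have hcard := hA.card_pos
  have : Nonempty A := hA.to_subtype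
  set a : A := A.orderIsoOfFin rfl ⟨0, hcard⟩ with ha
  set b : A := A.orderIsoOfFin rfl ⟨A.card - 1, by omega⟩ with hb
  have hfirst (j : A) : x a.1 ≤ x j.1 := by
    refine hmono (Subtype.coe_le_coe.2 ?_)
    rw [ha, ← OrderIso.le_symm_apply]
    exact Fin.mk_le_of_le_val (Nat.zero_le _)
  have hlast (j : A) : x j.1 ≤ x b.1 := by
    refine hmono (Subtype.coe_le_coe.2 ?_)
    rw [hb, ← OrderIso.symm_apply_le]
    exact Fin.le_def.2 (by have := ((A.orderIsoOfFin rfl).symm j).2; simp only; omega)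
  change _ ∧ (_ → cost0 x A = max (x a.1) (1 - x b.1))
  simp only [ccost0, cost0, if_pos hA]
  refine ⟨ciSup_mono hbdd fun s => iInf_circle_le_iInf_abs_sub x A s.1, fun hlt => ?_⟩
  refine le_antisymm ?_ (max_le ?_ ?_)
  · refine (le_max_iff.1 (ciSup_le fun s => ?_)).resolve_right hlt.not_ge
    have hle (j : A) : ⨅ j : A, |s.1 - x j.1| ≤ |s.1 - x j.1| :=
      ciInf_le (Set.finite_range _).bddBelow j
    obtain ⟨hs0, hs1⟩ := s.2
    rcases le_total s.1 (x a.1) with hsa | hsa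
    · refine le_max_of_le_left (le_max_of_le_left ((hle a).trans ?_))
      rw [abs_of_nonpos (by linarith)]
      linarith
    rcases le_total (x b.1) s.1 with hsb | hsb
    · refine le_max_of_le_left (le_max_of_le_right ((hle b).trans ?_))
      rw [abs_of_nonneg (by linarith)]
      linarith
    · exact le_max_of_le_right
        ((iInf_abs_sub_le_iInf_circle hx a b hsa hsb).trans (le_ciSup hcbdd s))
  · refine le_ciSup_of_le hbdd ⟨0, by simp⟩ (le_ciInf fun j => ?_)
    rw [zero_sub, abs_neg]
    exact (hfirst j).trans (le_abs_self _)
  · refine le_ciSup_of_le hbdd ⟨1, by simp⟩ (le_ciInf fun j => ?_)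
    exact (sub_le_sub_left (hlast j) 1).trans (le_abs_self _)
end

section
/- For any n ≥ 1 and p ∈ (0,1), the equispaced placement satisfies C(x^eq) ≤ C̃(x^eq) + (2/n) · p/(1−p). -/
open Finset MeasureTheory

/-- All sensors of `S` fail with probability `p ^ #S`. -/
lemma sum_prob_disjoint {n : ℕ} (p : ℝ) (S : Finset (Fin n)) :
    ∑ A : Finset (Fin n), prob p A * (if Disjoint A S then 1 else 0) = p ^ S.card := by
  have hfilter : univ.filter (fun A : Finset (Fin n) => Disjoint A S) = Sᶜ.powerset := by
    ext A
    simp [Finset.subset_compl_iff_disjoint_right]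
  simp only [mul_ite, mul_one, mul_zero]
  rw [← Finset.sum_filter, hfilter]
  have hbinom := Finset.sum_pow_mul_eq_add_pow (1 - p) p Sᶜ
  rw [sub_add_cancel, one_pow] at hbinom
  rw [← mul_one (p ^ S.card), ← hbinom, Finset.mul_sum]
  refine Finset.sum_congr rfl fun A hA => ?_
  have hle := Finset.card_le_card (Finset.mem_powerset.1 hA)
  have hS := Finset.card_add_card_compl S
  rw [Fintype.card_fin] at hS
  have hsplit : n - A.card = S.card + (Sᶜ.card - A.card) := by omega
  rw [prob, hsplit, pow_add]
  ring

/-- The number of initial segments `{0, …, k}` that miss `A`. -/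
noncomputable def leadingGap {n : ℕ} (A : Finset (Fin n)) : ℝ :=
  ∑ k : Fin n, if Disjoint A (Finset.Iic k) then 1 else 0

/-- The number of final segments `{k, …, n-1}` that miss `A`. -/
noncomputable def trailingGap {n : ℕ} (A : Finset (Fin n)) : ℝ :=
  ∑ k : Fin n, if Disjoint A (Finset.Ici k) then 1 else 0

lemma leadingGap_nonneg {n : ℕ} (A : Finset (Fin n)) : 0 ≤ leadingGap A :=
  Finset.sum_nonneg fun _ _ => by split_ifs <;> norm_num

lemma trailingGap_nonneg {n : ℕ} (A : Finset (Fin n)) : 0 ≤ trailingGap A :=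
  Finset.sum_nonneg fun _ _ => by split_ifs <;> norm_num

lemma min'_le_leadingGap {n : ℕ} (A : Finset (Fin n)) (hA : A.Nonempty) :
    ((A.min' hA : Fin n) : ℝ) ≤ leadingGap A := by
  rw [leadingGap, Finset.sum_boole]
  have hsub : Finset.Iio (A.min' hA) ⊆
      univ.filter (fun k : Fin n => Disjoint A (Finset.Iic k)) := by
    intro k hk
    simp only [Finset.mem_filter, Finset.mem_univ, true_and, Finset.disjoint_left,
      Finset.mem_Iic, not_le]
    exact fun i hi => (Finset.mem_Iio.1 hk).trans_le (A.min'_le i hi)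
  have hcard := Finset.card_le_card hsub
  rw [Fin.card_Iio] at hcard
  exact_mod_cast hcard

lemma sub_max'_le_trailingGap {n : ℕ} (A : Finset (Fin n)) (hA : A.Nonempty) :
    (n : ℝ) - 1 - ((A.max' hA : Fin n) : ℝ) ≤ trailingGap A := by
  rw [trailingGap, Finset.sum_boole]
  have hsub : Finset.Ioi (A.max' hA) ⊆
      univ.filter (fun k : Fin n => Disjoint A (Finset.Ici k)) := by
    intro k hk
    simp only [Finset.mem_filter, Finset.mem_univ, true_and, Finset.disjoint_left,
      Finset.mem_Ici, not_le]
    exact fun i hi => (A.le_max' i hi).trans_lt (Finset.mem_Ioi.1 hk)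
  have hcard := Finset.card_le_card hsub
  rw [Fin.card_Ioi] at hcard
  have hnat : n ≤ (univ.filter (fun k : Fin n => Disjoint A (Finset.Ici k))).card + 1 +
      (A.max' hA : Fin n) := by omega
  have hreal : (n : ℝ) ≤ (univ.filter (fun k : Fin n => Disjoint A (Finset.Ici k))).card + 1 +
      ((A.max' hA : Fin n) : ℝ) := by exact_mod_cast hnat
  linarith

lemma sum_range_pow_succ_le {p : ℝ} (hp : p ∈ Set.Ioo (0 : ℝ) 1) (n : ℕ) :
    ∑ k ∈ Finset.range n, p ^ (k + 1) ≤ p / (1 - p) := by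
  have h1 : 0 < 1 - p := sub_pos.2 hp.2
  have hgeom := geom_sum_mul_neg p n
  simp only [pow_succ]
  rw [← Finset.sum_mul, le_div_iff₀ h1]
  have hpn : 0 < p ^ n := pow_pos hp.1 n
  nlinarith [hp.1]

lemma sum_prob_mul_leadingGap_le {n : ℕ} {p : ℝ} (hp : p ∈ Set.Ioo (0 : ℝ) 1) :
    ∑ A : Finset (Fin n), prob p A * leadingGap A ≤ p / (1 - p) := by
  simp only [leadingGap, Finset.mul_sum]
  rw [Finset.sum_comm]
  simp only [sum_prob_disjoint, Fin.card_Iic]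
  rw [Fin.sum_univ_eq_sum_range (fun k => p ^ (k + 1))]
  exact sum_range_pow_succ_le hp n

lemma sum_prob_mul_trailingGap_le {n : ℕ} {p : ℝ} (hp : p ∈ Set.Ioo (0 : ℝ) 1) :
    ∑ A : Finset (Fin n), prob p A * trailingGap A ≤ p / (1 - p) := by
  simp only [trailingGap, Finset.mul_sum]
  rw [Finset.sum_comm]
  simp only [sum_prob_disjoint, Fin.card_Ici]
  rw [Fin.sum_univ_eq_sum_range (fun k => p ^ (n - k)),
    ← Finset.sum_range_reflect (fun k => p ^ (n - k))]
  refine le_trans (le_of_eq (Finset.sum_congr rfl fun k hk => ?_)) (sum_range_pow_succ_le hp n)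
  have hkn := Finset.mem_range.1 hk
  congr 1
  omega

lemma xeq_mono {n : ℕ} : Monotone (xeq n) := by
  intro i j hij
  have hcast : (i : ℝ) ≤ (j : ℝ) := by exact_mod_cast hij
  unfold xeq
  gcongr

lemma xeq_eq {n : ℕ} (hn : 1 ≤ n) (i : Fin n) : xeq n i = (i : ℝ) / n + 1 / (2 * n) := by
  have hn0 : (n : ℝ) ≠ 0 := by exact_mod_cast (by omega : n ≠ 0)
  unfold xeq
  field_simp

lemma one_sub_xeq {n : ℕ} (hn : 1 ≤ n) (i : Fin n) :
    1 - xeq n i = ((n : ℝ) - 1 - i) / n + 1 / (2 * n) := by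
  have hn0 : (n : ℝ) ≠ 0 := by exact_mod_cast (by omega : n ≠ 0)
  unfold xeq
  field_simp
  ring

lemma le_xeq {n : ℕ} (hn : 1 ≤ n) (i : Fin n) : 1 / (2 * (n : ℝ)) ≤ xeq n i := by
  rw [xeq_eq hn]
  have : 0 ≤ (i : ℝ) / n := by positivity
  linarith

lemma le_one_sub_xeq {n : ℕ} (hn : 1 ≤ n) (i : Fin n) : 1 / (2 * (n : ℝ)) ≤ 1 - xeq n i := by
  rw [one_sub_xeq hn]
  have hi : (i : ℝ) + 1 ≤ n := by exact_mod_cast i.2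
  have : 0 ≤ ((n : ℝ) - 1 - i) / n := div_nonneg (by linarith) (by positivity)
  linarith

lemma iInf_circle_le_ccost0 {n : ℕ} (x : Fin n → ℝ) {A : Finset (Fin n)} (hA : A.Nonempty)
    (s : Set.Icc (0 : ℝ) 1) :
    ⨅ j : A, min |s.1 - x j.1| (1 - |s.1 - x j.1|) ≤ ccost0 x A := by
  rw [ccost0, if_pos hA]
  refine le_ciSup (f := fun s : Set.Icc (0 : ℝ) 1 =>
    ⨅ j : A, min |s.1 - x j.1| (1 - |s.1 - x j.1|)) ⟨1 / 2, ?_⟩ s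
  rintro _ ⟨t, rfl⟩
  obtain ⟨j, hj⟩ := hA
  refine (ciInf_le (Set.finite_range _).bddBelow ⟨j, hj⟩).trans ?_
  rcases le_total |t.1 - x j| (1 / 2) with h | h
  · exact (min_le_left _ _).trans h
  · exact (min_le_right _ _).trans (by linarith)

lemma le_ccost0_xeq {n : ℕ} (hn : 1 ≤ n) {A : Finset (Fin n)} (hA : A.Nonempty) :
    1 / (2 * (n : ℝ)) ≤ ccost0 (xeq n) A := by
  have : Nonempty A := hA.to_subtype
  refine le_trans (le_ciInf fun j => ?_)
    (iInf_circle_le_ccost0 (xeq n) hA ⟨0, by norm_num, by norm_num⟩)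
  have h0 : 0 ≤ xeq n j.1 := le_trans (by positivity) (le_xeq hn j.1)
  rw [zero_sub, abs_neg, abs_of_nonneg h0]
  exact le_min (le_xeq hn _) (le_one_sub_xeq hn _)

lemma cost0_xeq_le {n : ℕ} (hn : 1 ≤ n) (A : Finset (Fin n)) :
    cost0 (xeq n) A ≤ ccost0 (xeq n) A + (leadingGap A + trailingGap A) / n := by
  have hlead : 0 ≤ leadingGap A / n := div_nonneg (leadingGap_nonneg A) (by positivity)
  have htrail : 0 ≤ trailingGap A / n := div_nonneg (trailingGap_nonneg A) (by positivity)
  rw [add_div]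
  by_cases hA : A.Nonempty
  swap
  · rw [cost0, ccost0, if_neg hA, if_neg hA]
    linarith
  have : Nonempty A := hA.to_subtype
  have : Nonempty (Set.Icc (0 : ℝ) 1) := ⟨⟨0, by norm_num, by norm_num⟩⟩
  have hbase := le_ccost0_xeq hn hA
  rw [cost0, if_pos hA]
  refine ciSup_le fun s => ?_
  have hinf : ∀ j ∈ A, ⨅ j : A, |s.1 - xeq n j.1| ≤ |s.1 - xeq n j| := fun j hj =>
    ciInf_le (f := fun j : A => |s.1 - xeq n j.1|) (Set.finite_range _).bddBelow ⟨j, hj⟩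
  generalize ⨅ j : A, |s.1 - xeq n j.1| = d at hinf ⊢
  have hfirst := hinf _ (A.min'_mem hA)
  have hlast := hinf _ (A.max'_mem hA)
  obtain ⟨hs0, hs1⟩ := s.2
  rcases lt_or_ge s.1 (xeq n (A.min' hA)) with hleft | hleft
  · rw [abs_of_neg (by linarith), xeq_eq hn] at hfirst
    have := div_le_div_of_nonneg_right (min'_le_leadingGap A hA) (Nat.cast_nonneg (α := ℝ) n)
    linarith
  rcases lt_or_ge (xeq n (A.max' hA)) s.1 with hright | hright
  · rw [abs_of_pos (by linarith)] at hlast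
    have hend := one_sub_xeq hn (A.max' hA)
    have := div_le_div_of_nonneg_right (sub_max'_le_trailingGap A hA)
      (Nat.cast_nonneg (α := ℝ) n)
    linarith
  -- Between two active sensors, going around the circle never shortens the distance.
  have hcircle : d ≤ ccost0 (xeq n) A := by
    refine le_trans (le_ciInf fun j => ?_) (iInf_circle_le_ccost0 (xeq n) hA s)
    refine le_min (hinf j.1 j.2) ?_
    rw [abs_of_nonneg (by linarith)] at hfirst
    rw [abs_of_nonpos (by linarith)] at hlast
    have hpos : 0 ≤ 1 / (2 * (n : ℝ)) := by positivity
    have h1 := le_xeq hn j.1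
    have h2 := le_one_sub_xeq hn j.1
    have h3 := le_xeq hn (A.min' hA)
    have h4 := le_one_sub_xeq hn (A.max' hA)
    rcases abs_cases (s.1 - xeq n j.1) with ⟨h, -⟩ | ⟨h, -⟩ <;> rw [h] <;> linarith
  linarith

/-- `C(x^eq) ≤ C̃(x^eq) + (2/n)·p/(1-p)`. -/
theorem expCost_xeq_le_circle {n : ℕ} (hn : 1 ≤ n) (p : ℝ)
    (hp : p ∈ Set.Ioo (0:ℝ) 1) :
    expCost p (xeq n) ≤ cExpCost p (xeq n) + 2 / n * (p / (1 - p)) := by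
  have hq : 0 ≤ 1 - p := by linarith [hp.2]
  calc expCost p (xeq n)
      ≤ ∑ A : Finset (Fin n), prob p A *
          (ccost0 (xeq n) A + (leadingGap A + trailingGap A) / n) :=
        Finset.sum_le_sum fun A _ => mul_le_mul_of_nonneg_left (cost0_xeq_le hn A)
          (mul_nonneg (pow_nonneg hp.1.le _) (pow_nonneg hq _))
    _ = cExpCost p (xeq n) + ((∑ A : Finset (Fin n), prob p A * leadingGap A) +
          ∑ A : Finset (Fin n), prob p A * trailingGap A) / n := by
        rw [cExpCost, ← Finset.sum_add_distrib, Finset.sum_div, ← Finset.sum_add_distrib]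
        exact Finset.sum_congr rfl fun A _ => by ring
    _ ≤ cExpCost p (xeq n) + (p / (1 - p) + p / (1 - p)) / n := by
        gcongr
        · exact sum_prob_mul_leadingGap_le hp
        · exact sum_prob_mul_trailingGap_le hp
    _ = cExpCost p (xeq n) + 2 / n * (p / (1 - p)) := by ring
end
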